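/- Fix an odd L ≥ 3, d ≥ 2, m ≥ 1, and integers k ≤ N̄ ≤ N. Let π : T_N → T_{N̄} be the canonical projection of discrete tori and τ : 𝒱_{N̄} → 𝒱_N the pull-back of fields, (τφ)(x) = φ(πx). Let 𝒞_k be a translation invariant positive semi-definite operator on 𝒱_N = (ℝ^m)^{T_N} whose kernel C_k : T_N → ℝ^{m×m}_sym satisfies C_k(x) = −M for d_∞(x,0) ≥ L^k/2, where M is a positive semi-definite symmetric matrix, and let μ_k be the centered Gaussian measure on 𝒱_N with covariance 𝒞_k. Let X ⊂ T_N with D = diam_∞(X), and assume L^{N̄} > 2D ≥ L^{N̄−1}. Define the Gaussian measure ν_{k,N̄} on 𝒱_{N̄} by its covariance operator 𝒟_{k,N̄} with kernel D_{k,N̄}(x̄) = (L^{(N−N̄)d} − 1) M + L^{−N̄d} Σ_{p ∈ T̂_{N̄}} e^{ip·x̄} Ĉ_k(p), where Ĉ_k(p) are the Fourier coefficients of C_k (well defined since T̂_{N̄} ⊂ T̂_N). Then for every measurable F_X : 𝒱_N → ℝ that depends only on {φ(x) : x ∈ X}, one has ∫_{𝒱_N} F_X(ξ) μ_k(dξ)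 = ∫_{𝒱_{N̄}} F_X(τψ) ν_{k,N̄}(dψ). -/

import Mathlib

open Matrix Complex MeasureTheory
open scoped Matrix BigOperators ComplexOrder

noncomputable section

/-- The discrete torus `T_N = (ℤ/L^Nℤ)^d`. -/
abbrev Torus (L N d : ℕ) := Fin d → ZMod (L ^ N)

/-- Quotient maximum distance `d_∞` on the discrete torus. -/
def torusDist {L N d : ℕ} (x y : Torus L N d) : ℕ :=
  Finset.univ.sup fun i => min (x i - y i).val (L ^ N - (x i - y i).val)

/-- The point of the dual torus `T̂_N ⊂ (-π,π)^d` associated to `k : T_N`. -/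
def dualPt (L N d : ℕ) (k : Torus L N d) : Fin d → ℝ := fun i =>
  2 * Real.pi *
    (if 2 * (k i).val + 1 ≤ L ^ N then ((k i).val : ℝ) else ((k i).val : ℝ) - L ^ N) /
    (L ^ N : ℝ)

/-- Euclidean norm of a frequency vector. -/
def pnorm {d : ℕ} (p : Fin d → ℝ) : ℝ := Real.sqrt (∑ i, p i ^ 2)

/-- `p` lies in the dyadic annulus `A_j` of the dual torus. -/
def inAnn (L : ℕ) {d : ℕ} (j : ℕ) (p : Fin d → ℝ) : Prop :=
  if j = 0 then ((L : ℝ))⁻¹ < pnorm p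
  else ((L : ℝ) ^ (j + 1))⁻¹ < pnorm p ∧ pnorm p ≤ ((L : ℝ) ^ j)⁻¹

/-- Fourier transform of a matrix-valued kernel at frequency `p`:
`Ĉ(p) = Σ_x e^{−ip·x} C(x)`. -/
def fourierAt {L N d m : ℕ} [NeZero (L ^ N)]
    (C : Torus L N d → Matrix (Fin m) (Fin m) ℝ) (p : Fin d → ℝ) :
    Matrix (Fin m) (Fin m) ℂ :=
  ∑ x : Torus L N d,
    Complex.exp (-Complex.I * ∑ i, (p i : ℂ) * ((x i).val : ℂ)) • (C x).map Complex.ofReal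

/-- Forward shift by a multiindex. -/
def shiftF {L N d : ℕ} (β : Fin d → ℕ) (x : Torus L N d) : Torus L N d :=
  fun i => x i + (β i : ZMod (L ^ N))

/-- Backward shift by a multiindex. -/
def shiftB {L N d : ℕ} (β : Fin d → ℕ) (x : Torus L N d) : Torus L N d :=
  fun i => x i - (β i : ZMod (L ^ N))

/-- The mixed discrete forward derivative `∇^α` (binomial formula). -/
def nablaF {L N d : ℕ} {E : Type*} [AddCommGroup E] [Module ℝ E]
    (α : Fin d → ℕ) (f : Torus L N d → E) (x : Torus L N d) : E :=
  ∑ β ∈ Fintype.piFinset fun i => Finset.range (α i + 1),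
    ((-1 : ℝ) ^ (∑ i, (α i - β i)) * ∏ i, ((α i).choose (β i) : ℝ)) • f (shiftF β x)

/-- The mixed discrete backward derivative `(∇^α)^*` (binomial formula). -/
def nablaB {L N d : ℕ} {E : Type*} [AddCommGroup E] [Module ℝ E]
    (α : Fin d → ℕ) (f : Torus L N d → E) (x : Torus L N d) : E :=
  ∑ β ∈ Fintype.piFinset fun i => Finset.range (α i + 1),
    ((-1 : ℝ) ^ (∑ i, (α i - β i)) * ∏ i, ((α i).choose (β i) : ℝ)) • f (shiftB β x)

/-- Index set for the block matrix `A : G → G`, `G = (ℝ^m)^𝓜`. -/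
abbrev Idx (d m : ℕ) (𝓜 : Finset (Fin d → ℕ)) := {α // α ∈ 𝓜} × Fin m

/-- `ℓ²`-operator norm of `A : G → G`. -/
def opA {d m : ℕ} {𝓜 : Finset (Fin d → ℕ)} (A : Idx d m 𝓜 → Idx d m 𝓜 → ℝ) : ℝ :=
  ‖Matrix.toEuclideanCLM (𝕜 := ℝ) (Matrix.of A)‖

/-- `ℓ²`-operator norm of a complex `m×m` matrix. -/
def opC {m : ℕ} (M : Matrix (Fin m) (Fin m) ℂ) : ℝ :=
  ‖Matrix.toEuclideanCLM (𝕜 := ℂ) M‖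

/-- `ℓ²`-operator norm of a real `m×m` matrix. -/
def opR {m : ℕ} (M : Matrix (Fin m) (Fin m) ℝ) : ℝ :=
  ‖Matrix.toEuclideanCLM (𝕜 := ℝ) M‖

/-- The elliptic finite difference operator `𝒜 = Σ_{α,β∈𝓜} (∇^α)^* A_{αβ} ∇^β`. -/
def Aop {L N d m : ℕ} {𝓜 : Finset (Fin d → ℕ)}
    (A : Idx d m 𝓜 → Idx d m 𝓜 → ℝ) (φ : Torus L N d → Fin m → ℝ) :
    Torus L N d → Fin m → ℝ :=
  fun x r => ∑ α : {a // a ∈ 𝓜}, ∑ β : {a // a ∈ 𝓜}, ∑ s : Fin m,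
    A (α, r) (β, s) * nablaB α.1 (nablaF β.1 fun z => φ z s) x

/-- The set `𝓛(G, ω₀, Ω₀)`: symmetric `A` with `‖A‖ ≤ Ω₀` and `(z, Az) ≥ ω₀|z^∇|²`
(the gradient components being the multiindices of order 1). -/
def memL (d m : ℕ) (𝓜 : Finset (Fin d → ℕ)) (ω₀ Ω₀ : ℝ)
    (A : Idx d m 𝓜 → Idx d m 𝓜 → ℝ) : Prop :=
  (∀ a b, A a b = A b a) ∧ opA A ≤ Ω₀ ∧
    ∀ z : Idx d m 𝓜 → ℝ,
      ω₀ * ∑ a : Idx d m 𝓜, (if (∑ i, (a.1 : Fin d → ℕ) i) = 1 then z a ^ 2 else 0) ≤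
        ∑ a, ∑ b, z a * A a b * z b

/-- Action of a translation invariant operator given by its kernel: `(𝒞φ)(x) = Σ_y C(x−y)φ(y)`. -/
def kerApp {L N d m : ℕ} [NeZero (L ^ N)]
    (C : Torus L N d → Matrix (Fin m) (Fin m) ℝ) (φ : Torus L N d → Fin m → ℝ) :
    Torus L N d → Fin m → ℝ :=
  fun x => ∑ y, C (x - y) *ᵥ φ y

/-- Quadratic form `⟨φ, 𝒞φ⟩` of a translation invariant operator with kernel `C`. -/
def quadForm {L N d m : ℕ} [NeZero (L ^ N)]
    (C : Torus L N d → Matrix (Fin m) (Fin m) ℝ) (φ : Torus L N d → Fin m → ℝ) : ℝ :=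
  ∑ x, φ x ⬝ᵥ kerApp C φ x

end

/-- The scalar product `⟨v, φ⟩ = Σ_x v(x)·φ(x)` of two fields. -/
def innerF {L N d m : ℕ} [NeZero (L ^ N)]
    (v φ : Torus L N d → Fin m → ℝ) : ℝ :=
  ∑ x, v x ⬝ᵥ φ x

/-- The canonical projection `π : T_N → T_{N̄}` as a homomorphism of additive groups. -/
def torusProj {L Nb N : ℕ} (d : ℕ) (hNb : Nb ≤ N) : Torus L N d →+ Torus L Nb d :=
  (ZMod.castHom (pow_dvd_pow L hNb) (ZMod (L ^ Nb))).toAddMonoidHom.compLeft (Fin d)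

theorem torusProj_apply {L Nb N d : ℕ} (hNb : Nb ≤ N) (x : Torus L N d) (i : Fin d) :
    torusProj d hNb x i = ZMod.castHom (pow_dvd_pow L hNb) (ZMod (L ^ Nb)) (x i) := rfl

theorem torusProj_surjective {L Nb N d : ℕ} (hNb : Nb ≤ N) :
    Function.Surjective (torusProj (L := L) d hNb) := by
  intro y
  choose x hx using fun i =>
    ZMod.castHom_surjective (pow_dvd_pow L hNb) (y i)
  exact ⟨x, funext hx⟩

theorem card_fiber_torusProj {L Nb N d : ℕ} [NeZero (L ^ N)] [NeZero (L ^ Nb)]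
    (hNb : Nb ≤ N) (y : Torus L Nb d) :
    (Finset.univ.filter fun x : Torus L N d => torusProj d hNb x = y).card =
      L ^ ((N - Nb) * d) := by
  have hcard : ∀ z : Torus L Nb d,
      (Finset.univ.filter fun x : Torus L N d => torusProj d hNb x = z).card =
        (Finset.univ.filter fun x : Torus L N d => torusProj d hNb x = y).card := fun z =>
    AddMonoidHom.card_fiber_eq_of_mem_range (torusProj d hNb)
      (torusProj_surjective hNb z) (torusProj_surjective hNb y)
  have hsum := Finset.card_eq_sum_card_fiberwise (s := (Finset.univ : Finset (Torus L N d)))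
    (t := Finset.univ) (f := torusProj d hNb) (fun _ _ => Finset.mem_coe.2 (Finset.mem_univ _))
  rw [Finset.sum_congr rfl fun z _ => hcard z] at hsum
  simp only [Finset.card_univ, Fintype.card_pi, ZMod.card, Finset.prod_const, Fintype.card_fin,
    Finset.sum_const, smul_eq_mul] at hsum
  have hpos : 0 < (L ^ Nb) ^ d := pow_pos (Nat.pos_of_ne_zero (NeZero.ne _)) d
  refine Nat.eq_of_mul_eq_mul_left hpos (hsum.symm.trans ?_)
  rw [← pow_mul, ← pow_mul, ← pow_add, ← add_mul, Nat.add_sub_cancel' hNb]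

/-- Distinct residues modulo `n` that agree modulo `b ∣ n` are at distance at least `b`. -/
theorem ZMod.le_add_of_castHom_eq {n b : ℕ} [NeZero n] (h : b ∣ n) {x y : ZMod n}
    (hxy : ZMod.castHom h (ZMod b) x = ZMod.castHom h (ZMod b) y) (hne : x ≠ y) :
    b ≤ min x.val (n - x.val) + min y.val (n - y.val) := by
  wlog hlt : x.val < y.val generalizing x y
  · have hne' : x.val ≠ y.val := fun e => hne (ZMod.val_injective n e)
    rw [add_comm]
    exact this hxy.symm hne.symm (by omega)
  have hyn := y.val_lt
  have hmod : x.val ≡ y.val [MOD b] := by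
    rw [← ZMod.natCast_eq_natCast_iff, ZMod.natCast_val, ZMod.natCast_val]
    exact hxy
  have hdvd : b ∣ y.val - x.val := (Nat.modEq_iff_dvd' hlt.le).1 hmod
  have h₁ : b ≤ y.val - x.val := Nat.le_of_dvd (by omega) hdvd
  have h₂ : b ≤ n - (y.val - x.val) := Nat.le_of_dvd (by omega) (Nat.dvd_sub h hdvd)
  omega

theorem lt_two_mul_torusDist_of_torusProj_eq {L Nb N d : ℕ} [NeZero (L ^ N)] (hNb : Nb ≤ N)
    {x y : Torus L N d} (hx : 2 * torusDist x 0 < L ^ Nb)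
    (hxy : torusProj d hNb x = torusProj d hNb y) (hne : x ≠ y) :
    L ^ Nb < 2 * torusDist y 0 := by
  obtain ⟨i, hi⟩ := Function.ne_iff.1 hne
  have hle := ZMod.le_add_of_castHom_eq (pow_dvd_pow L hNb) (congrFun hxy i) hi
  have hcoord : ∀ z : Torus L N d, min (z i).val (L ^ N - (z i).val) ≤ torusDist z 0 := by
    intro z
    simpa [torusDist] using Finset.le_sup
      (f := fun j => min ((z j - (0 : Torus L N d) j).val) (L ^ N - (z j - (0 : Torus L N d) j).val))
      (Finset.mem_univ i)
  have h₁ := hcoord x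
  have h₂ := hcoord y
  omega

theorem exp_dualPt {L N d : ℕ} [NeZero (L ^ N)] (q : Torus L N d) (i : Fin d) (t : ℤ) :
    Complex.exp (Complex.I * ((dualPt L N d q i : ℂ) * t)) =
      ZMod.stdAddChar (q i * (t : ZMod (L ^ N))) := by
  have key : ∀ c : ℤ, (c : ZMod (L ^ N)) = q i →
      dualPt L N d q i = 2 * Real.pi * (c : ℝ) / (L ^ N : ℝ) →
      Complex.exp (Complex.I * ((dualPt L N d q i : ℂ) * t)) =
        ZMod.stdAddChar (q i * (t : ZMod (L ^ N))) := by
    intro c hc hp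
    rw [← hc, ← Int.cast_mul, ZMod.stdAddChar_coe, hp]
    congr 1
    push_cast
    ring
  by_cases h : 2 * (q i).val + 1 ≤ L ^ N
  · exact key (q i).val (by simp) (by simp [dualPt, h])
  · refine key ((q i).val - (L ^ N : ℕ)) ?_ ?_
    · rw [Int.cast_sub, Int.cast_natCast, Int.cast_natCast, ZMod.natCast_self]
      simp
    · simp only [dualPt, if_neg h]
      push_cast
      rfl

/-- Orthogonality of the characters of the discrete torus. -/
theorem sum_exp_dualPt {L N d : ℕ} [NeZero (L ^ N)] (t : Fin d → ℤ) :
    ∑ q : Torus L N d, Complex.exp (Complex.I * ∑ i, (dualPt L N d q i : ℂ) * (t i : ℂ)) =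
      if ∀ i, (t i : ZMod (L ^ N)) = 0 then (L : ℂ) ^ (N * d) else 0 := by
  simp_rw [Finset.mul_sum, Complex.exp_sum, exp_dualPt]
  rw [← Fintype.prod_sum (fun i (a : ZMod (L ^ N)) =>
    ZMod.stdAddChar (a * (t i : ZMod (L ^ N))))]
  simp_rw [AddChar.sum_mulShift _ (ZMod.isPrimitive_stdAddChar (L ^ N)), ZMod.card]
  split_ifs with h
  · simp [h, pow_mul]
  · push Not at h
    obtain ⟨i, hi⟩ := h
    exact Finset.prod_eq_zero (Finset.mem_univ i) (by simp [hi])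

/-- Restricting the Fourier coefficients to the coarser dual torus periodises the kernel. -/
theorem sum_exp_smul_fourierAt {L Nb N d m : ℕ} [NeZero (L ^ N)] [NeZero (L ^ Nb)]
    (hNb : Nb ≤ N) (C : Torus L N d → Matrix (Fin m) (Fin m) ℝ) (y : Torus L Nb d) :
    ((L : ℂ) ^ (Nb * d))⁻¹ • ∑ q : Torus L Nb d,
        Complex.exp (Complex.I * ∑ i, (dualPt L Nb d q i : ℂ) * ((y i).val : ℂ)) •
          fourierAt C (dualPt L Nb d q) =
      ∑ x with torusProj d hNb x = y, (C x).map Complex.ofReal := by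
  have hL : (L : ℂ) ^ (Nb * d) ≠ 0 := by
    have h : L ^ (Nb * d) ≠ 0 := by
      rw [pow_mul]
      exact pow_ne_zero d (NeZero.ne _)
    exact_mod_cast h
  have hphase : ∀ (q : Torus L Nb d) (x : Torus L N d),
      Complex.exp (Complex.I * ∑ i, (dualPt L Nb d q i : ℂ) * ((y i).val : ℂ)) *
        Complex.exp (-Complex.I * ∑ i, (dualPt L Nb d q i : ℂ) * ((x i).val : ℂ)) =
      Complex.exp (Complex.I * ∑ i, (dualPt L Nb d q i : ℂ) *
        (((y i).val - (x i).val : ℤ) : ℂ)) := by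
    intro q x
    rw [← Complex.exp_add, neg_mul, ← sub_eq_add_neg, ← mul_sub, ← Finset.sum_sub_distrib]
    push_cast
    simp_rw [mul_sub]
  have hcond : ∀ x : Torus L N d,
      (∀ i, (((y i).val - (x i).val : ℤ) : ZMod (L ^ Nb)) = 0) ↔ torusProj d hNb x = y := by
    intro x
    rw [eq_comm, funext_iff]
    refine forall_congr' fun i => ?_
    rw [torusProj_apply, Int.cast_sub, sub_eq_zero, Int.cast_natCast, Int.cast_natCast,
      ZMod.natCast_zmod_val, ZMod.natCast_val, ZMod.castHom_apply]
  simp_rw [fourierAt, Finset.smul_sum (s := (Finset.univ : Finset (Torus L N d))), smul_smul,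
    hphase]
  rw [Finset.sum_comm]
  simp_rw [← Finset.sum_smul, sum_exp_dualPt, hcond]
  rw [Finset.smul_sum, Finset.sum_filter]
  refine Finset.sum_congr rfl fun x _ => ?_
  split_ifs with h
  · rw [smul_smul, inv_mul_cancel₀ hL, one_smul]
  · simp

/-- The periodised kernel agrees with the original one at short distance. -/
theorem periodised_kernel_eq {L Nb N d m k : ℕ} [NeZero (L ^ N)] [NeZero (L ^ Nb)]
    (hL : 1 ≤ L) (hk : k ≤ Nb) (hNb : Nb ≤ N)
    {C : Torus L N d → Matrix (Fin m) (Fin m) ℝ} {M : Matrix (Fin m) (Fin m) ℝ}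
    (hC : ∀ x : Torus L N d, ((L : ℝ) ^ k) / 2 ≤ (torusDist x 0 : ℝ) → C x = -M)
    {x : Torus L N d} (hx : 2 * torusDist x 0 < L ^ Nb) :
    ((L : ℂ) ^ ((N - Nb) * d) - 1) • M.map Complex.ofReal +
      ((L : ℂ) ^ (Nb * d))⁻¹ • ∑ q : Torus L Nb d,
        Complex.exp (Complex.I * ∑ i, (dualPt L Nb d q i : ℂ) *
          ((torusProj d hNb x i).val : ℂ)) • fourierAt C (dualPt L Nb d q) =
      (C x).map Complex.ofReal := by
  rw [sum_exp_smul_fourierAt hNb]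
  have hxmem : x ∈ Finset.univ.filter
      (fun z : Torus L N d => torusProj d hNb z = torusProj d hNb x) := by simp
  have hfar : ∀ z ∈ (Finset.univ.filter
      (fun z : Torus L N d => torusProj d hNb z = torusProj d hNb x)).erase x,
      (C z).map Complex.ofReal = -M.map Complex.ofReal := by
    intro z hz
    rw [Finset.mem_erase, Finset.mem_filter] at hz
    have hlt := lt_two_mul_torusDist_of_torusProj_eq hNb hx hz.2.2.symm hz.1.symm
    have hle : L ^ k ≤ 2 * torusDist z 0 := (Nat.pow_le_pow_right hL hk).trans hlt.le
    have hle' : (L : ℝ) ^ k ≤ 2 * (torusDist z 0 : ℝ) := by exact_mod_cast hle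
    rw [hC z (by linarith)]
    ext
    simp
  rw [← Finset.add_sum_erase _ _ hxmem, Finset.sum_congr rfl hfar, Finset.sum_const,
    Finset.card_erase_of_mem hxmem, card_fiber_torusProj, ← Nat.cast_smul_eq_nsmul ℂ,
    Nat.cast_sub (Nat.one_le_pow _ _ hL)]
  push_cast
  rw [smul_neg]
  abel

theorem innerF_comp_torusProj {L Nb N d m : ℕ} [NeZero (L ^ N)] [NeZero (L ^ Nb)]
    (hNb : Nb ≤ N) (v : Torus L N d → Fin m → ℝ) (ψ : Torus L Nb d → Fin m → ℝ) :
    innerF v (fun x => ψ (torusProj d hNb x)) =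
      innerF (fun y => ∑ x with torusProj d hNb x = y, v x) ψ := by
  simp_rw [innerF, sum_dotProduct]
  rw [← Finset.sum_fiberwise (Finset.univ : Finset (Torus L N d)) (torusProj d hNb)]
  refine Finset.sum_congr rfl fun y _ => Finset.sum_congr rfl fun x hx => ?_
  rw [(Finset.mem_filter.1 hx).2]

theorem quadForm_eq_sum {L N d m : ℕ} [NeZero (L ^ N)]
    (C : Torus L N d → Matrix (Fin m) (Fin m) ℝ) (v : Torus L N d → Fin m → ℝ) :
    quadForm C v = ∑ x, ∑ y, ∑ r, ∑ s, v x r * C (x - y) r s * v y s := by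
  simp_rw [quadForm, kerApp, dotProduct_sum, dotProduct, mulVec, dotProduct, Finset.mul_sum,
    mul_assoc]

theorem sum_fiberwise_bilinear {α β : Type*} [Fintype α] [Fintype β] [DecidableEq β] {m : ℕ}
    (p : α → β) (v : α → Fin m → ℝ) (D : β → β → Matrix (Fin m) (Fin m) ℂ) :
    (∑ a, ∑ b, ∑ r, ∑ s, (((∑ x with p x = a, v x) r : ℝ) : ℂ) * D a b r s *
        (((∑ x with p x = b, v x) s : ℝ) : ℂ)) =
      ∑ x, ∑ y, ∑ r, ∑ s, (v x r : ℂ) * D (p x) (p y) r s * (v y s : ℂ) := by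
  have hleft : ∀ f : α → β → ℂ, ∑ x, f x (p x) = ∑ a, ∑ x with p x = a, f x a := by
    intro f
    rw [← Finset.sum_fiberwise (Finset.univ : Finset α) p]
    refine Finset.sum_congr rfl fun a _ => Finset.sum_congr rfl fun x hx => ?_
    rw [(Finset.mem_filter.1 hx).2]
  have hmul : ∀ (A B : Finset α) (E : Matrix (Fin m) (Fin m) ℂ),
      (∑ r, ∑ s, (((∑ x ∈ A, v x) r : ℝ) : ℂ) * E r s * (((∑ x ∈ B, v x) s : ℝ) : ℂ)) =
        ∑ x ∈ A, ∑ y ∈ B, ∑ r, ∑ s, (v x r : ℂ) * E r s * (v y s : ℂ) := by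
    intro A B E
    simp_rw [Finset.sum_apply, Complex.ofReal_sum, Finset.sum_mul, Finset.mul_sum]
    rw [Finset.sum_congr rfl fun r _ => Finset.sum_comm, Finset.sum_comm]
    refine Finset.sum_congr rfl fun x _ => ?_
    rw [Finset.sum_congr rfl fun r _ => Finset.sum_comm, Finset.sum_comm]
  rw [hleft fun x a => ∑ y, ∑ r, ∑ s, (v x r : ℂ) * D a (p y) r s * (v y s : ℂ)]
  refine Finset.sum_congr rfl fun a _ => ?_
  rw [Finset.sum_congr rfl fun x _ =>
    hleft fun y b => ∑ r, ∑ s, (v x r : ℂ) * D a b r s * (v y s : ℂ)]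
  exact (Finset.sum_congr rfl fun b _ => hmul _ _ (D a b)).trans Finset.sum_comm

/-- Every continuous linear functional on fields is a scalar product with a field. -/
theorem exists_innerF_eq {L N d m : ℕ} [NeZero (L ^ N)]
    (ℓ : StrongDual ℝ (Torus L N d → Fin m → ℝ)) :
    ∃ v : Torus L N d → Fin m → ℝ, ∀ φ, ℓ φ = innerF v φ := by
  refine ⟨fun x r => ℓ (Pi.single x (Pi.single r 1)), fun φ => ?_⟩
  have hφ : φ = ∑ x, ∑ r, φ x r • (Pi.single x (Pi.single r 1) : Torus L N d → Fin m → ℝ) := by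
    ext x r
    simp [Finset.sum_apply, Pi.single_apply, ite_apply]
  conv_lhs => rw [hφ]
  simp_rw [map_sum, map_smul, innerF, dotProduct, smul_eq_mul, mul_comm]

/-- Two laws of fields whose characteristic functions agree are equal. -/
theorem measure_ext_of_innerF {L N d m : ℕ} [NeZero (L ^ N)]
    {μ ν : Measure (Torus L N d → Fin m → ℝ)} [IsFiniteMeasure μ] [IsFiniteMeasure ν]
    (h : ∀ v : Torus L N d → Fin m → ℝ,
      ∫ φ, Complex.exp (Complex.I * (innerF v φ : ℝ)) ∂μ =
        ∫ φ, Complex.exp (Complex.I * (innerF v φ : ℝ)) ∂ν) : μ = ν := by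
  refine Measure.ext_of_charFunDual (funext fun ℓ => ?_)
  obtain ⟨v, hv⟩ := exists_innerF_eq ℓ
  simp_rw [charFunDual_apply, hv, mul_comm _ Complex.I]
  exact h v

/-- **Localisation lemma** (Lemma 4.2 of the paper). If `𝒞_k` is a translation invariant
positive semi-definite operator on `𝒱_N` whose kernel is constantly `−M` at distance
`≥ L^k/2`, `μ_k` the corresponding centered Gaussian measure, `X` a set of diameter `D`
with `L^N̄ > 2D ≥ L^{N̄−1}`, and `ν_{k,N̄}` the Gaussian measure on `𝒱_{N̄}` whose
covariance kernel is `D_{k,N̄}(x̄) = (L^{(N−N̄)d}−1)M + L^{−N̄d} Σ_{p∈T̂_{N̄}} e^{ipx̄}Ĉ_k(p)`,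
then for every `F_X` depending only on the values on `X`,
`∫ F_X dμ_k = ∫ F_X(τψ) ν_{k,N̄}(dψ)` where `τ` is the pull-back along `π : T_N → T_{N̄}`. -/
theorem stmt14 (L d m k Nb N : ℕ) (hL : Odd L) (hL3 : 3 ≤ L) (hd : 2 ≤ d) (hm : 1 ≤ m)
    (hk : k ≤ Nb) (hNb : Nb ≤ N) [NeZero (L ^ N)] [NeZero (L ^ Nb)]
    (C : Torus L N d → Matrix (Fin m) (Fin m) ℝ)
    (hCsym : ∀ x, (C x).IsSymm)
    (hCpos : ∀ φ : Torus L N d → Fin m → ℝ, 0 ≤ quadForm C φ)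
    (M : Matrix (Fin m) (Fin m) ℝ) (hM : M.PosSemidef)
    (hC : ∀ x : Torus L N d, ((L : ℝ) ^ k) / 2 ≤ (torusDist x 0 : ℝ) → C x = -M)
    (X : Finset (Torus L N d))
    (hD1 : 2 * ((X ×ˢ X).sup fun q => torusDist q.1 q.2) < L ^ Nb)
    (hD2 : L ^ (Nb - 1) ≤ 2 * ((X ×ˢ X).sup fun q => torusDist q.1 q.2))
    (μ : Measure ((Torus L N d) → Fin m → ℝ)) (hμp : IsProbabilityMeasure μ)
    (hμ : ∀ v : Torus L N d → Fin m → ℝ,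
      ∫ φ, Complex.exp (Complex.I * (innerF v φ : ℝ)) ∂μ =
        Complex.exp (-(1 / 2 : ℂ) * (quadForm C v : ℝ)))
    (DkN : Torus L Nb d → Matrix (Fin m) (Fin m) ℂ)
    (hDkN : ∀ xb : Torus L Nb d, DkN xb =
      ((L : ℂ) ^ ((N - Nb) * d) - 1) • M.map Complex.ofReal +
      ((L : ℂ) ^ (Nb * d))⁻¹ • ∑ q : Torus L Nb d,
        Complex.exp (Complex.I * ∑ i, (dualPt L Nb d q i : ℂ) * ((xb i).val : ℂ)) •
          fourierAt C (dualPt L Nb d q))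
    (ν : Measure ((Torus L Nb d) → Fin m → ℝ)) (hνp : IsProbabilityMeasure ν)
    (hν : ∀ v : Torus L Nb d → Fin m → ℝ,
      ∫ ψ, Complex.exp (Complex.I * (innerF v ψ : ℝ)) ∂ν =
        Complex.exp (-(1 / 2 : ℂ) *
          ∑ xb, ∑ yb, ∑ r, ∑ s, (v xb r : ℂ) * DkN (xb - yb) r s * (v yb s : ℂ)))
    (F : ((Torus L N d) → Fin m → ℝ) → ℝ) (hFmeas : Measurable F)
    (hFX : ∀ φ ψ, (∀ x ∈ X, φ x = ψ x) → F φ = F ψ) :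
    ∫ ξ, F ξ ∂μ =
      ∫ ψ, F (fun x => ψ fun i =>
        ZMod.castHom (pow_dvd_pow L hNb) (ZMod (L ^ Nb)) (x i)) ∂ν := by
  have : IsProbabilityMeasure μ := hμp
  have : IsProbabilityMeasure ν := hνp
  have hcontinuous : ∀ v : Torus L N d → Fin m → ℝ, Continuous (innerF v) := by
    intro v
    unfold innerF dotProduct
    fun_prop
  have hcut : ∀ v φ : Torus L N d → Fin m → ℝ,
      innerF v (fun x => if x ∈ X then φ x else 0) =
        innerF (fun x => if x ∈ X then v x else 0) φ := by
    intro v φ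
    refine Finset.sum_congr rfl fun x _ => ?_
    by_cases hx : x ∈ X <;> simp [hx]
  have he : Measurable fun (φ : Torus L N d → Fin m → ℝ) x => if x ∈ X then φ x else 0 := by
    refine measurable_pi_lambda _ fun x => ?_
    split_ifs
    · exact measurable_pi_apply x
    · exact measurable_const
  have hτ : Measurable fun (ψ : Torus L Nb d → Fin m → ℝ) (x : Torus L N d) =>
      ψ (torusProj d hNb x) :=
    measurable_pi_lambda _ fun x => measurable_pi_apply _
  have hFcut : ∀ φ, F φ = F fun x => if x ∈ X then φ x else 0 := fun φ =>
    hFX _ _ fun x hx => (if_pos hx).symm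
  have hlaw : μ.map (fun φ x => if x ∈ X then φ x else 0) =
      ν.map (fun ψ x => if x ∈ X then ψ (torusProj d hNb x) else 0) := by
    have heτ : Measurable fun (ψ : Torus L Nb d → Fin m → ℝ) (x : Torus L N d) =>
        if x ∈ X then ψ (torusProj d hNb x) else 0 := he.comp hτ
    have := Measure.isProbabilityMeasure_map (μ := μ) he.aemeasurable
    have := Measure.isProbabilityMeasure_map (μ := ν) heτ.aemeasurable
    refine measure_ext_of_innerF fun v => ?_
    have hmeas : Continuous fun φ : Torus L N d → Fin m → ℝ =>
        Complex.exp (Complex.I * (innerF v φ : ℝ)) := by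
      have := hcontinuous v
      fun_prop
    rw [integral_map he.aemeasurable hmeas.aestronglyMeasurable,
      integral_map heτ.aemeasurable hmeas.aestronglyMeasurable]
    simp_rw [hcut v]
    rw [hμ]
    simp_rw [innerF_comp_torusProj hNb]
    rw [hν, sum_fiberwise_bilinear (torusProj d hNb) _ fun a b => DkN (a - b), quadForm_eq_sum]
    congr 2
    push_cast
    refine Finset.sum_congr rfl fun x _ => Finset.sum_congr rfl fun y _ =>
      Finset.sum_congr rfl fun r _ => Finset.sum_congr rfl fun s _ => ?_
    by_cases hx : x ∈ X
    · by_cases hy : y ∈ X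
      · have hdist : torusDist (x - y) 0 ≤ (X ×ˢ X).sup fun q => torusDist q.1 q.2 := by
          have h := Finset.le_sup (f := fun q : Torus L N d × Torus L N d => torusDist q.1 q.2)
            (Finset.mk_mem_product hx hy)
          simpa [torusDist] using h
        rw [← map_sub, hDkN, periodised_kernel_eq (by omega) hk hNb hC (by omega)]
        rfl
      · simp [hy]
    · simp [hx]
  calc ∫ ξ, F ξ ∂μ = ∫ ξ, F (fun x => if x ∈ X then ξ x else 0) ∂μ := by simp_rw [← hFcut]
    _ = ∫ φ, F φ ∂μ.map (fun φ x => if x ∈ X then φ x else 0) :=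
      (integral_map he.aemeasurable hFmeas.aestronglyMeasurable).symm
    _ = ∫ φ, F φ ∂ν.map (fun ψ x => if x ∈ X then ψ (torusProj d hNb x) else 0) := by rw [hlaw]
    _ = ∫ ψ, F (fun x => if x ∈ X then ψ (torusProj d hNb x) else 0) ∂ν :=
      integral_map (he.comp hτ).aemeasurable hFmeas.aestronglyMeasurable
    _ = ∫ ψ, F (fun x => ψ (torusProj d hNb x)) ∂ν :=
      integral_congr_ae (.of_forall fun ψ => (hFcut _).symm)
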